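/- arXiv:q-alg/9504005 — 9 statements merged into one kernel-verified Lean document; each statement's English description precedes it below -/
import Mathlib

section
/- Let 𝔤 be a Lie algebra over ℂ, A an associative unital ℂ-algebra, ι : 𝔤 → A a Lie algebra homomorphism into A equipped with the commutator bracket, θ : 𝔤 → A a linear map, and Ω ∈ A ⊗ A an element satisfying [Ω, ι(X) ⊗ 1 + 1 ⊗ ι(X)] = 0 for all X ∈ 𝔤. Define Δ(X) = ι(X) ⊗ 1 + 1 ⊗ ι(X) and Δθ(Y) = θ(Y) ⊗ 1 + 1 ⊗ θ(Y) + [Ω, ι(Y) ⊗ 1]. Then for all X, Y ∈ 𝔤, writing R for the linear span in A of the elements [ι(X'), θ(Y')] − θ([X', Y']) over all X', Y' ∈ 𝔤, one has [Δ(X), Δθ(Y)] − Δθ([X, Y]) ∈ R ⊗ A + A ⊗ R. -/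
open scoped TensorProduct

/-- Let 𝔤 be a Lie algebra over ℂ, `A` an associative unital ℂ-algebra,
`ι : 𝔤 → A` a Lie algebra homomorphism into `A` with the commutator bracket,
`θ : 𝔤 → A` a linear map, and `Ω ∈ A ⊗ A` commuting with `ι X ⊗ 1 + 1 ⊗ ι X` for all `X`.
With `Δ X = ι X ⊗ 1 + 1 ⊗ ι X` and `Δθ Y = θ Y ⊗ 1 + 1 ⊗ θ Y + [Ω, ι Y ⊗ 1]`, the element
`[Δ X, Δθ Y] − Δθ [X,Y]` lies in `R ⊗ A + A ⊗ R`, where `R` is the span of the elements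
`[ι X', θ Y'] − θ [X', Y']`. -/
theorem yangian_coproduct_relation_mod_R
    {g : Type*} [LieRing g] [LieAlgebra ℂ g]
    {A : Type*} [Ring A] [Algebra ℂ A]
    (ι : g →ₗ[ℂ] A) (hι : ∀ X Y : g, ι ⁅X, Y⁆ = ι X * ι Y - ι Y * ι X)
    (θ : g →ₗ[ℂ] A)
    (Ω : A ⊗[ℂ] A)
    (hΩ : ∀ X : g,
      Ω * (ι X ⊗ₜ[ℂ] 1 + 1 ⊗ₜ[ℂ] ι X) - (ι X ⊗ₜ[ℂ] 1 + 1 ⊗ₜ[ℂ] ι X) * Ω = 0)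
    (Δ : g → A ⊗[ℂ] A)
    (hΔ : ∀ X : g, Δ X = ι X ⊗ₜ[ℂ] 1 + 1 ⊗ₜ[ℂ] ι X)
    (Δθ : g → A ⊗[ℂ] A)
    (hΔθ : ∀ Y : g, Δθ Y = θ Y ⊗ₜ[ℂ] 1 + 1 ⊗ₜ[ℂ] θ Y
      + (Ω * (ι Y ⊗ₜ[ℂ] 1) - (ι Y ⊗ₜ[ℂ] 1) * Ω))
    (R : Submodule ℂ A)
    (hR : R = Submodule.span ℂ
      {r : A | ∃ X' Y' : g, r = (ι X' * θ Y' - θ Y' * ι X') - θ ⁅X', Y'⁆})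
    (X Y : g) :
    (Δ X * Δθ Y - Δθ Y * Δ X) - Δθ ⁅X, Y⁆ ∈
      Submodule.span ℂ
        ({t : A ⊗[ℂ] A | ∃ r ∈ R, ∃ s : A, t = r ⊗ₜ[ℂ] s} ∪
         {t : A ⊗[ℂ] A | ∃ s : A, ∃ r ∈ R, t = s ⊗ₜ[ℂ] r}) := by
  have hcomm : Ω * Δ X = Δ X * Ω := by
    rw [hΔ]
    exact sub_eq_zero.mp (hΩ X)
  have hbracket : (ι ⁅X, Y⁆) ⊗ₜ[ℂ] (1 : A) = Δ X * (ι Y ⊗ₜ[ℂ] 1) - (ι Y ⊗ₜ[ℂ] 1) * Δ X := by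
    simp only [hΔ, hι, add_mul, mul_add, Algebra.TensorProduct.tmul_mul_tmul, mul_one, one_mul,
      TensorProduct.sub_tmul]
    abel
  have hprim : Δ X * (θ Y ⊗ₜ[ℂ] 1 + 1 ⊗ₜ[ℂ] θ Y) - (θ Y ⊗ₜ[ℂ] 1 + 1 ⊗ₜ[ℂ] θ Y) * Δ X
      = (ι X * θ Y - θ Y * ι X) ⊗ₜ[ℂ] 1 + 1 ⊗ₜ[ℂ] (ι X * θ Y - θ Y * ι X) := by
    simp only [hΔ, add_mul, mul_add, Algebra.TensorProduct.tmul_mul_tmul, mul_one, one_mul,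
      TensorProduct.sub_tmul, TensorProduct.tmul_sub]
    abel
  have hinner : ∀ D W P : A ⊗[ℂ] A, W * D = D * W →
      D * (W * P - P * W) - (W * P - P * W) * D
        = W * (D * P - P * D) - (D * P - P * D) * W := by
    intro D W P h
    have hleft : D * (W * P) = W * (D * P) := by rw [← mul_assoc, ← h, mul_assoc]
    have hright : P * W * D = P * D * W := by rw [mul_assoc, h, mul_assoc]
    simp only [mul_sub, sub_mul, hleft, hright, mul_assoc]
    abel
  have hr : (ι X * θ Y - θ Y * ι X) - θ ⁅X, Y⁆ ∈ R := hR ▸ Submodule.subset_span ⟨X, Y, rfl⟩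
  have key : (Δ X * Δθ Y - Δθ Y * Δ X) - Δθ ⁅X, Y⁆
      = ((ι X * θ Y - θ Y * ι X) - θ ⁅X, Y⁆) ⊗ₜ[ℂ] 1
        + 1 ⊗ₜ[ℂ] ((ι X * θ Y - θ Y * ι X) - θ ⁅X, Y⁆) := by
    rw [hΔθ, hΔθ, hbracket, ← hinner _ _ _ hcomm, mul_add (Δ X), add_mul _ _ (Δ X),
      add_sub_add_comm, hprim, TensorProduct.sub_tmul _ (θ ⁅X, Y⁆),
      TensorProduct.tmul_sub _ _ (θ ⁅X, Y⁆)]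
    abel
  rw [key]
  exact add_mem (Submodule.subset_span (Or.inl ⟨_, hr, 1, rfl⟩))
    (Submodule.subset_span (Or.inr ⟨1, _, hr, rfl⟩))
end

section
/- Let 𝔤 be a Lie algebra over ℂ, A an associative unital ℂ-algebra, ι : 𝔤 → A a Lie algebra homomorphism into A equipped with the commutator bracket, θ : 𝔤 → A a linear map, and Ω ∈ A ⊗ A an element satisfying [Ω, ι(X) ⊗ 1 + 1 ⊗ ι(X)] = 0 for all X ∈ 𝔤. Define Δ(X) = ι(X) ⊗ 1 + 1 ⊗ ι(X) and Δθ(Y) = θ(Y) ⊗ 1 + 1 ⊗ θ(Y) + [Ω, ι(Y) ⊗ 1]. Then for all X, Y ∈ 𝔤, setting r = [ι(X), θ(Y)] − θ([X, Y]), one has the exact identity [Δ(X), Δθ(Y)] = Δθ([X, Y]) + r ⊗ 1 + 1 ⊗ r. -/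
open scoped TensorProduct

/-- With the same setup as Statement 0, for all `X Y`, setting
`r = [ι X, θ Y] − θ [X,Y]`, one has the exact identity
`[Δ X, Δθ Y] = Δθ [X,Y] + r ⊗ 1 + 1 ⊗ r`. -/
theorem yangian_coproduct_relation_exact
    {g : Type*} [LieRing g] [LieAlgebra ℂ g]
    {A : Type*} [Ring A] [Algebra ℂ A]
    (ι : g →ₗ[ℂ] A) (hι : ∀ X Y : g, ι ⁅X, Y⁆ = ι X * ι Y - ι Y * ι X)
    (θ : g →ₗ[ℂ] A)
    (Ω : A ⊗[ℂ] A)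
    (hΩ : ∀ X : g,
      Ω * (ι X ⊗ₜ[ℂ] 1 + 1 ⊗ₜ[ℂ] ι X) - (ι X ⊗ₜ[ℂ] 1 + 1 ⊗ₜ[ℂ] ι X) * Ω = 0)
    (Δ : g → A ⊗[ℂ] A)
    (hΔ : ∀ X : g, Δ X = ι X ⊗ₜ[ℂ] 1 + 1 ⊗ₜ[ℂ] ι X)
    (Δθ : g → A ⊗[ℂ] A)
    (hΔθ : ∀ Y : g, Δθ Y = θ Y ⊗ₜ[ℂ] 1 + 1 ⊗ₜ[ℂ] θ Y
      + (Ω * (ι Y ⊗ₜ[ℂ] 1) - (ι Y ⊗ₜ[ℂ] 1) * Ω))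
    (X Y : g)
    (r : A) (hr : r = (ι X * θ Y - θ Y * ι X) - θ ⁅X, Y⁆) :
    Δ X * Δθ Y - Δθ Y * Δ X = Δθ ⁅X, Y⁆ + r ⊗ₜ[ℂ] 1 + 1 ⊗ₜ[ℂ] r := by
  have hcomm : Ω * Δ X = Δ X * Ω := by
    rw [hΔ]
    exact sub_eq_zero.mp (hΩ X)
  have hleft (a : A) :
      Δ X * (a ⊗ₜ[ℂ] 1) - (a ⊗ₜ[ℂ] 1) * Δ X = (ι X * a - a * ι X) ⊗ₜ[ℂ] 1 := by
    simp only [hΔ, add_mul, mul_add, Algebra.TensorProduct.tmul_mul_tmul, one_mul, mul_one,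
      TensorProduct.sub_tmul]
    abel
  have hright (a : A) :
      Δ X * (1 ⊗ₜ[ℂ] a) - (1 ⊗ₜ[ℂ] a) * Δ X = 1 ⊗ₜ[ℂ] (ι X * a - a * ι X) := by
    simp only [hΔ, add_mul, mul_add, Algebra.TensorProduct.tmul_mul_tmul, one_mul, mul_one,
      TensorProduct.tmul_sub]
    abel
  have hΩι (P : A ⊗[ℂ] A) :
      Δ X * (Ω * P - P * Ω) - (Ω * P - P * Ω) * Δ X
        = Ω * (Δ X * P - P * Δ X) - (Δ X * P - P * Δ X) * Ω := by
    simp only [mul_sub, sub_mul, ← mul_assoc, hcomm]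
    simp only [mul_assoc, hcomm]
    abel
  calc
    Δ X * Δθ Y - Δθ Y * Δ X
        = (Δ X * (θ Y ⊗ₜ[ℂ] 1) - (θ Y ⊗ₜ[ℂ] 1) * Δ X)
          + (Δ X * (1 ⊗ₜ[ℂ] θ Y) - (1 ⊗ₜ[ℂ] θ Y) * Δ X)
          + (Δ X * (Ω * (ι Y ⊗ₜ[ℂ] 1) - (ι Y ⊗ₜ[ℂ] 1) * Ω)
            - (Ω * (ι Y ⊗ₜ[ℂ] 1) - (ι Y ⊗ₜ[ℂ] 1) * Ω) * Δ X) := by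
      rw [hΔθ, mul_add, mul_add, add_mul, add_mul]
      abel
    _ = Δθ ⁅X, Y⁆ + r ⊗ₜ[ℂ] 1 + 1 ⊗ₜ[ℂ] r := by
      rw [hΩι, hleft, hleft, hright, hΔθ, ← hι, hr, TensorProduct.sub_tmul _ (θ ⁅X, Y⁆),
        TensorProduct.tmul_sub _ _ (θ ⁅X, Y⁆)]
      abel
end

section
/- Let A be an associative unital ℂ-algebra containing elements a_m (m ∈ ℤ), b_m (m ∈ ℤ) and H satisfying the commutator relations [a_m, a_n] = m·δ_{m+n,0}·a_0, [H, a_m] = m·a_m, [a_m, b_n] = m·a_{m+n}, and [H, b_m] = m·b_m for all m, n ∈ ℤ. Suppose moreover that for every m, n ∈ ℤ the element c_{mn} := [b_m, b_n] − (m − n)·b_{m+n} lies in the unital subalgebra of A generated by a_0. Then there exist elements F and G in the unital subalgebra generated by a_0 such that for all m, n ∈ ℤ: [b_m, b_n] = (m − n)·b_{m+n} + δ_{m+n,0}·(m³·F + m·G). -/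
/-- An odd function on `ℤ` satisfying the cocycle identity of the Witt algebra is
`m ↦ m³ F + m G`, with `F` and `G` determined by its values at `1` and `2`. -/
theorem odd_witt_cocycle_eq_cubic {M : Type*} [AddCommGroup M] [Module ℂ M] (e : ℤ → M)
    (hodd : ∀ m, e (-m) = -e m)
    (hcocycle : ∀ m n : ℤ, ((m : ℂ) - n) • e (-(m + n)) + ((m : ℂ) + 2 * n) • e m
      - (2 * (m : ℂ) + n) • e n = 0) (m : ℤ) :
    e m = (m : ℂ) ^ 3 • ((1 / 6 : ℂ) • (e 2 - (2 : ℂ) • e 1))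
      + (m : ℂ) • (e 1 - (1 / 6 : ℂ) • (e 2 - (2 : ℂ) • e 1)) := by
  have hzero : e 0 = 0 := by
    have h := hodd 0
    rw [neg_zero] at h
    linear_combination (norm := module) (1 / 2 : ℂ) • h
  have hnat : ∀ k : ℕ, e ((k : ℤ) + 2) =
      ((k : ℂ) + 2) ^ 3 • ((1 / 6 : ℂ) • (e 2 - (2 : ℂ) • e 1))
        + ((k : ℂ) + 2) • (e 1 - (1 / 6 : ℂ) • (e 2 - (2 : ℂ) • e 1)) := by
    intro k
    induction k with
    | zero => simp only [Nat.cast_zero, zero_add]; module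
    | succ k ih =>
      have h := hcocycle ((k : ℤ) + 2) 1
      rw [hodd, ih] at h
      have hk : (k : ℂ) + 1 ≠ 0 := by exact_mod_cast Nat.succ_ne_zero k
      rw [show ((k + 1 : ℕ) : ℤ) + 2 = (k : ℤ) + 2 + 1 by push_cast; ring]
      refine (smul_right_injective M hk) ?_
      push_cast at h ⊢
      linear_combination (norm := module) (-1 : ℂ) • h
  have hnonneg : ∀ k : ℕ, e k =
      (k : ℂ) ^ 3 • ((1 / 6 : ℂ) • (e 2 - (2 : ℂ) • e 1))
        + (k : ℂ) • (e 1 - (1 / 6 : ℂ) • (e 2 - (2 : ℂ) • e 1)) := by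
    rintro (_ | _ | k)
    · simp [hzero]
    · simp
    · have h := hnat k
      push_cast
      rw [add_assoc, add_assoc, one_add_one_eq_two, one_add_one_eq_two]
      exact h
  obtain ⟨k, rfl | rfl⟩ := m.eq_nat_or_neg
  · exact_mod_cast hnonneg k
  · rw [hodd, hnonneg k]
    push_cast
    module

/-- An element commuting with `x` commutes with the subalgebra generated by `x`. -/
theorem Commute.of_mem_adjoin_singleton {R A : Type*} [CommSemiring R] [Semiring A] [Algebra R A]
    {x y z : A} (hxy : Commute y x) (hz : z ∈ Algebra.adjoin R {x}) : Commute y z := by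
  have hle : Algebra.adjoin R {x} ≤ Subalgebra.centralizer R {y} := by
    rw [Algebra.adjoin_le_iff, Set.singleton_subset_iff]
    rintro _ rfl
    exact hxy
  exact hle hz y rfl

/-- Let `A` be an associative unital ℂ-algebra containing elements
`a m` (`m ∈ ℤ`), `b m` (`m ∈ ℤ`) and `H` with `[a m, a n] = m δ_{m+n,0} a 0`,
`[H, a m] = m • a m`, `[a m, b n] = m • a (m+n)` and `[H, b m] = m • b m`.
If every `c_{mn} = [b m, b n] − (m−n) • b (m+n)` lies in the unital subalgebra generated
by `a 0`, then there are `F G` in that subalgebra with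
`[b m, b n] = (m−n) • b (m+n) + δ_{m+n,0} (m³ • F + m • G)` for all `m n`. -/
theorem virasoro_form_of_central_terms
    {A : Type*} [Ring A] [Algebra ℂ A]
    (a b : ℤ → A) (H : A)
    (haa : ∀ m n : ℤ, a m * a n - a n * a m =
      (if m + n = 0 then (m : ℂ) else 0) • a 0)
    (hHa : ∀ m : ℤ, H * a m - a m * H = (m : ℂ) • a m)
    (hab : ∀ m n : ℤ, a m * b n - b n * a m = (m : ℂ) • a (m + n))
    (hHb : ∀ m : ℤ, H * b m - b m * H = (m : ℂ) • b m)
    (hc : ∀ m n : ℤ,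
      (b m * b n - b n * b m) - ((m : ℂ) - n) • b (m + n) ∈ Algebra.adjoin ℂ {a 0}) :
    ∃ F G : A, F ∈ Algebra.adjoin ℂ {a 0} ∧ G ∈ Algebra.adjoin ℂ {a 0} ∧
      ∀ m n : ℤ, b m * b n - b n * b m =
        ((m : ℂ) - n) • b (m + n) +
          (if m + n = 0 then (1 : ℂ) else 0) • ((m : ℂ) ^ 3 • F + (m : ℂ) • G) := by
  let lieRing : LieRing A := LieRing.ofAssociativeRing
  let lieAlgebra : LieAlgebra ℂ A := LieAlgebra.ofAssociativeAlgebra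
  set c : ℤ → ℤ → A := fun m n => ⁅b m, b n⁆ - ((m : ℂ) - n) • b (m + n) with hcdef
  have hbb : ∀ m n, ⁅b m, b n⁆ = ((m : ℂ) - n) • b (m + n) + c m n := fun m n => by
    simp [hcdef]
  have hHb' : ∀ m, ⁅H, b m⁆ = (m : ℂ) • b m := hHb
  have hHc : ∀ m n, ⁅H, c m n⁆ = 0 := fun m n => by
    have h0 : Commute H (a 0) := sub_eq_zero.mp (by simpa using hHa 0)
    exact sub_eq_zero.mpr (h0.of_mem_adjoin_singleton (hc m n))
  have hbc : ∀ k m n, ⁅b k, c m n⁆ = 0 := fun k m n => by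
    have h0 : Commute (b k) (a 0) := (sub_eq_zero.mp (by simpa using hab 0 k)).symm
    exact sub_eq_zero.mpr (h0.of_mem_adjoin_singleton (hc m n))
  have hc_zero : ∀ m n : ℤ, m + n ≠ 0 → c m n = 0 := fun m n hmn => by
    have h := leibniz_lie H (b m) (b n)
    simp only [hbb, hHb', hHc, lie_add, lie_smul, smul_lie] at h
    have hmn' : (m : ℂ) + n ≠ 0 := by exact_mod_cast hmn
    refine (smul_eq_zero.mp ?_).resolve_left hmn'
    push_cast at h
    linear_combination (norm := module) (-1 : ℂ) • h
  have hc_skew : ∀ m n, c n m = -c m n := fun m n => by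
    simp only [hcdef]
    rw [← lie_skew (b m) (b n), add_comm n m]
    module
  have hcocycle : ∀ m n : ℤ, ((m : ℂ) - n) • c (-(m + n)) (m + n)
      + ((m : ℂ) + 2 * n) • c m (-m) - (2 * (m : ℂ) + n) • c n (-n) = 0 := fun m n => by
    have h := leibniz_lie (b (-(m + n))) (b m) (b n)
    rw [hbb m n, hbb (-(m + n)) m, hbb (-(m + n)) n] at h
    rw [show -(m + n) + m = -n by ring, show -(m + n) + n = -m by ring] at h
    rw [add_lie, ← lie_skew (c _ _) (b n)] at h
    simp only [hbb, hbc, lie_add, lie_smul, smul_lie] at h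
    rw [hc_skew n (-n)] at h
    rw [show -(m + n) + (m + n) = 0 by ring, show -n + n = 0 by ring,
      show m + -m = 0 by ring] at h
    push_cast at h
    linear_combination (norm := module) h
  have hcubic := odd_witt_cocycle_eq_cubic (fun m => c m (-m))
    (fun m => by simpa using hc_skew m (-m)) (fun m n => by simpa using hcocycle m n)
  have hF : (1 / 6 : ℂ) • (c 2 (-2) - (2 : ℂ) • c 1 (-1)) ∈ Algebra.adjoin ℂ {a 0} :=
    Subalgebra.smul_mem _ (sub_mem (hc _ _) (Subalgebra.smul_mem _ (hc _ _) _)) _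
  refine ⟨_, _, hF, sub_mem (hc 1 (-1)) hF, fun m n => ?_⟩
  refine (hbb m n).trans (congrArg _ ?_)
  split_ifs with hmn
  · obtain rfl := neg_eq_of_add_eq_zero_right hmn
    rw [one_smul]
    exact hcubic m
  · rw [zero_smul, hc_zero m n hmn]
end

section
/- Let V be a vector space over ℂ and let c : ℤ → V satisfy c_{−m} = −c_m for all m ∈ ℤ and (m − n)·c_{m+n} − (m + 2n)·c_m + (2m + n)·c_n = 0 for all m, n ∈ ℤ. Then there exist u, v ∈ V such that c_m = m·u + m³·v for all m ∈ ℤ; explicitly, u = (1/6)(8·c_1 − c_2) and v = (1/6)(c_2 − 2·c_1). -/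
/-- The equation at `n = 1` is a recursion determining `c` on integers `≥ 2`. -/
theorem central_equation_natCast_add_two
    {V : Type*} [AddCommGroup V] [Module ℂ V] (c : ℤ → V)
    (hrec : ∀ m : ℤ,
      ((m : ℂ) - 1) • c (m + 1) = ((m : ℂ) + 2) • c m - (2 * (m : ℂ) + 1) • c 1)
    (k : ℕ) :
    c (k + 2) = ((k : ℂ) + 2) • ((1 / 6 : ℂ) • ((8 : ℂ) • c 1 - c 2))
      + ((k : ℂ) + 2) ^ 3 • ((1 / 6 : ℂ) • (c 2 - (2 : ℂ) • c 1)) := by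
  induction k with
  | zero =>
    simp only [Nat.cast_zero, zero_add]
    module
  | succ k ih =>
    have hk : (k : ℂ) + 1 ≠ 0 := by exact_mod_cast k.succ_ne_zero
    have h := hrec (k + 2)
    rw [ih] at h
    rw [show ((k + 1 : ℕ) : ℤ) + 2 = k + 2 + 1 by push_cast; ring]
    apply smul_right_injective V hk
    dsimp only
    push_cast at h ⊢
    rw [show (k : ℂ) + 1 = k + 2 - 1 by ring, h]
    module

/-- If `c : ℤ → V` is odd and satisfies
`(m−n) • c (m+n) − (m+2n) • c m + (2m+n) • c n = 0`, then `c m = m • u + m³ • v` with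
`u = (1/6) • (8 • c 1 − c 2)` and `v = (1/6) • (c 2 − 2 • c 1)`. -/
theorem odd_solutions_of_central_equation
    {V : Type*} [AddCommGroup V] [Module ℂ V]
    (c : ℤ → V)
    (hodd : ∀ m : ℤ, c (-m) = -c m)
    (heq : ∀ m n : ℤ,
      ((m : ℂ) - n) • c (m + n) - ((m : ℂ) + 2 * n) • c m
        + (2 * (m : ℂ) + n) • c n = 0) :
    ∃ u v : V,
      (∀ m : ℤ, c m = (m : ℂ) • u + (m : ℂ) ^ 3 • v) ∧
      u = (1 / 6 : ℂ) • ((8 : ℂ) • c 1 - c 2) ∧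
      v = (1 / 6 : ℂ) • (c 2 - (2 : ℂ) • c 1) := by
  refine ⟨_, _, ?_, rfl, rfl⟩
  have hrec (m : ℤ) :
      ((m : ℂ) - 1) • c (m + 1) = ((m : ℂ) + 2) • c m - (2 * (m : ℂ) + 1) • c 1 := by
    have h := heq m 1
    push_cast at h
    rw [← sub_eq_zero, ← h]
    module
  have hzero : c 0 = 0 := by simpa using heq 1 0
  have hnat (k : ℕ) :
      c k = (k : ℂ) • ((1 / 6 : ℂ) • ((8 : ℂ) • c 1 - c 2))
        + (k : ℂ) ^ 3 • ((1 / 6 : ℂ) • (c 2 - (2 : ℂ) • c 1)) := by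
    match k with
    | 0 => simp [hzero]
    | 1 =>
      simp only [Nat.cast_one]
      module
    | k + 2 => simpa using central_equation_natCast_add_two c hrec k
  intro m
  obtain ⟨k, rfl | rfl⟩ := m.eq_nat_or_neg
  · simpa using hnat k
  · rw [hodd, hnat k]
    push_cast
    module
end

section
/- Let L be a Lie algebra over ℂ and let b_m (m ∈ ℤ) and c_m (m ∈ ℤ) be elements of L such that each c_m commutes with every b_k, and such that [b_m, b_n] = (m − n)·b_{m+n} + δ_{m+n,0}·c_m for all m, n ∈ ℤ. Then there exist elements F, G ∈ L, each commuting with every b_k, such that [b_m, b_n] = (m − n)·b_{m+n} + δ_{m+n,0}·(m³·F + m·G) for all m, n ∈ ℤ. -/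
/-- An odd function `c : ℤ → M` satisfying the Gelfand–Fuchs recursion is a combination of
`m ^ 3` and `m`, with coefficients determined by `c 1` and `c 2`. -/
theorem eq_cube_smul_add_smul_of_recursion {K M : Type*} [Field K] [CharZero K]
    [AddCommGroup M] [Module K M] (c : ℤ → M) (hodd : ∀ m : ℤ, c (-m) = -c m)
    (hrec : ∀ m : ℤ, ((m : K) - 1) • c (m + 1) =
      ((m : K) + 2) • c m - (2 * (m : K) + 1) • c 1) (m : ℤ) :
    c m = (m : K) ^ 3 • ((6 : K)⁻¹ • (c 2 - (2 : K) • c 1)) +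
      (m : K) • (c 1 - (6 : K)⁻¹ • (c 2 - (2 : K) • c 1)) := by
  have : IsAddTorsionFree M := .of_isTorsionFree K M
  have hnat (n : ℕ) : c n = (n : K) ^ 3 • ((6 : K)⁻¹ • (c 2 - (2 : K) • c 1)) +
      (n : K) • (c 1 - (6 : K)⁻¹ • (c 2 - (2 : K) • c 1)) := by
    match n with
    | 0 => simpa [self_eq_neg] using hodd 0
    | 1 => simp
    | k + 2 =>
      induction k with
      | zero =>
        push_cast
        module
      | succ k ih =>
        have hk : (k : K) + 1 ≠ 0 := by exact_mod_cast k.succ_ne_zero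
        have h := hrec ((k + 2 : ℕ) : ℤ)
        rw [ih] at h
        push_cast at h ⊢
        rw [show (k : ℤ) + 1 + 2 = k + 2 + 1 by ring]
        apply smul_right_injective M hk
        simp only
        rw [show (k : K) + 1 = k + 2 - 1 by ring, h]
        module
  obtain ⟨n, rfl | rfl⟩ := m.eq_nat_or_neg
  · simpa using hnat n
  · rw [hodd, hnat]
    push_cast
    module

/-- Any central extension of the Witt-type bracket
`[b m, b n] = (m−n) • b (m+n)` by terms supported on `m + n = 0` is of Virasoro form:
there exist `F G`, commuting with every `b k`, such that
`[b m, b n] = (m−n) • b (m+n) + δ_{m+n,0} • (m³ • F + m • G)`. -/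
theorem central_extension_is_virasoro
    {L : Type*} [LieRing L] [LieAlgebra ℂ L]
    (b c : ℤ → L)
    (hcb : ∀ m k : ℤ, ⁅c m, b k⁆ = 0)
    (hbb : ∀ m n : ℤ, ⁅b m, b n⁆ =
      ((m : ℂ) - n) • b (m + n) + (if m + n = 0 then (1 : ℂ) else 0) • c m) :
    ∃ F G : L, (∀ k : ℤ, ⁅F, b k⁆ = 0) ∧ (∀ k : ℤ, ⁅G, b k⁆ = 0) ∧
      ∀ m n : ℤ, ⁅b m, b n⁆ =
        ((m : ℂ) - n) • b (m + n) +
          (if m + n = 0 then (1 : ℂ) else 0) • ((m : ℂ) ^ 3 • F + (m : ℂ) • G) := by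
  have hbb_neg (m : ℤ) : ⁅b m, b (-m)⁆ = (2 * (m : ℂ)) • b 0 + c m := by
    rw [hbb, add_neg_cancel, if_pos rfl, one_smul]
    push_cast
    module
  have hodd (m : ℤ) : c (-m) = -c m := by
    have h := lie_skew (b m) (b (-m))
    have h' := hbb_neg (-m)
    rw [neg_neg] at h'
    rw [hbb_neg, h'] at h
    push_cast at h
    linear_combination (norm := module) -h
  have hbc (m k : ℤ) : ⁅b k, c m⁆ = 0 := by rw [← lie_skew, hcb, neg_zero]
  have hlie (l m n : ℤ) (h : l + m + n = 0) :
      ⁅b l, ⁅b m, b n⁆⁆ = ((m : ℂ) - n) • ((2 * (l : ℂ)) • b 0 + c l) := by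
    rw [hbb m n, lie_add, lie_smul, lie_smul, hbc, smul_zero, add_zero,
      show m + n = -l by lia, hbb_neg]
  have hrec (m : ℤ) : ((m : ℂ) - 1) • c (m + 1) =
      ((m : ℂ) + 2) • c m - (2 * (m : ℂ) + 1) • c 1 := by
    have h := lie_jacobi (b 1) (b m) (b (-(m + 1)))
    rw [hlie _ _ _ (by ring), hlie _ _ _ (by ring), hlie _ _ _ (by ring), hodd] at h
    push_cast at h
    linear_combination (norm := module) h
  refine ⟨(6 : ℂ)⁻¹ • (c 2 - (2 : ℂ) • c 1), c 1 - (6 : ℂ)⁻¹ • (c 2 - (2 : ℂ) • c 1),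
    fun k => by simp [hcb], fun k => by simp [hcb], fun m n => ?_⟩
  rw [hbb, ← eq_cube_smul_add_smul_of_recursion c hodd hrec m]
end

section
/- Let A be an associative unital ℂ-algebra containing elements a_m (m ∈ ℤ) and H satisfying the commutator relations [a_m, a_n] = m·δ_{m+n,0}·a_0 and [H, a_m] = m·a_m for all m, n ∈ ℤ. For N ≥ 0 define ω_N = Σ_{m=−N}^{N} a_m ⊗ a_{−m} + a_0 ⊗ H + H ⊗ a_0 ∈ A ⊗ A. Then for every m ∈ ℤ with |m| ≤ N: [ω_N, a_m ⊗ 1] = m·(a_m ⊗ a_0 − a_0 ⊗ a_m). -/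
open scoped TensorProduct

/-- With `[a m, a n] = m δ_{m+n,0} • a 0` and `[H, a m] = m • a m`,
the truncated Casimir tensor `ω_N` satisfies
`[ω_N, a m ⊗ 1] = m • (a m ⊗ a 0 − a 0 ⊗ a m)` for `|m| ≤ N`. -/
theorem truncated_casimir_bracket_with_a
    {A : Type*} [Ring A] [Algebra ℂ A]
    (a : ℤ → A) (H : A)
    (haa : ∀ m n : ℤ, a m * a n - a n * a m =
      (if m + n = 0 then (m : ℂ) else 0) • a 0)
    (hHa : ∀ m : ℤ, H * a m - a m * H = (m : ℂ) • a m)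
    (N : ℕ)
    (ω : A ⊗[ℂ] A)
    (hω : ω = (∑ m ∈ Finset.Icc (-(N : ℤ)) (N : ℤ), a m ⊗ₜ[ℂ] a (-m))
      + a 0 ⊗ₜ[ℂ] H + H ⊗ₜ[ℂ] a 0) :
    ∀ m : ℤ, |m| ≤ (N : ℤ) →
      ω * (a m ⊗ₜ[ℂ] 1) - (a m ⊗ₜ[ℂ] 1) * ω =
        (m : ℂ) • (a m ⊗ₜ[ℂ] a 0 - a 0 ⊗ₜ[ℂ] a m) := by
  intro m hm
  have bracket_tmul : ∀ x y : A, x ⊗ₜ[ℂ] y * (a m ⊗ₜ[ℂ] 1) - (a m ⊗ₜ[ℂ] 1) * x ⊗ₜ[ℂ] y =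
      (x * a m - a m * x) ⊗ₜ[ℂ] y := by
    intro x y
    simp only [Algebra.TensorProduct.tmul_mul_tmul, mul_one, one_mul, TensorProduct.sub_tmul]
  have bracket_sum : (∑ k ∈ Finset.Icc (-(N : ℤ)) (N : ℤ), a k ⊗ₜ[ℂ] a (-k)) * (a m ⊗ₜ[ℂ] 1)
      - (a m ⊗ₜ[ℂ] 1) * (∑ k ∈ Finset.Icc (-(N : ℤ)) (N : ℤ), a k ⊗ₜ[ℂ] a (-k))
      = -((m : ℂ) • a 0 ⊗ₜ[ℂ] a m) := by
    rw [Finset.sum_mul, Finset.mul_sum, ← Finset.sum_sub_distrib, Finset.sum_eq_single (-m)]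
    · rw [bracket_tmul, haa]
      simp [TensorProduct.smul_tmul', TensorProduct.neg_tmul]
    · intro k _ hk
      rw [bracket_tmul, haa, if_neg (fun h => hk (by omega)), zero_smul, TensorProduct.zero_tmul]
    · intro h
      exact absurd (Finset.mem_Icc.mpr (by rw [abs_le] at hm; omega)) h
  have bracket_zero : a 0 ⊗ₜ[ℂ] H * (a m ⊗ₜ[ℂ] 1) - (a m ⊗ₜ[ℂ] 1) * a 0 ⊗ₜ[ℂ] H = 0 := by
    rw [bracket_tmul, haa]
    simp
  have bracket_H : H ⊗ₜ[ℂ] a 0 * (a m ⊗ₜ[ℂ] 1) - (a m ⊗ₜ[ℂ] 1) * H ⊗ₜ[ℂ] a 0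
      = (m : ℂ) • a m ⊗ₜ[ℂ] a 0 := by
    rw [bracket_tmul, hHa, TensorProduct.smul_tmul']
  rw [hω, add_mul, add_mul, mul_add, mul_add, add_sub_add_comm, add_sub_add_comm, bracket_sum,
    bracket_zero, bracket_H, smul_sub]
  abel
end

section
/- Let A be an associative unital ℂ-algebra containing elements a_m (m ∈ ℤ) and b_m (m ∈ ℤ) satisfying the commutator relations [a_m, a_n] = m·δ_{m+n,0}·a_0, [a_0, a_m] = 0, and [a_m, b_n] = m·a_{m+n} for all m, n ∈ ℤ. Let ε : ℤ → ℂ and for m ∈ ℤ define Δ(b_m) = b_m ⊗ 1 + 1 ⊗ b_m + ε_m·m·(a_m ⊗ a_0 − a_0 ⊗ a_m) ∈ A ⊗ A. Then for all m, n ∈ ℤ: [Δ(b_m), Δ(b_n)] = [b_m, b_n] ⊗ 1 + 1 ⊗ [b_m, b_n] + (ε_m·m² − ε_n·n²)·(a_{m+n} ⊗ a_0 − a_0 ⊗ a_{m+n}) − δ_{m+n,0}·ε_m·ε_{−m}·m³·(a_0 ⊗ a_0² + a_0² ⊗ a_0). -/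
open scoped TensorProduct

section TensorCommutators

variable {R A : Type*} [CommRing R] [Ring A] [Algebra R A]

/-- The primitive elements `x ⊗ 1 + 1 ⊗ x` are closed under commutators. -/
theorem primitive_mul_sub_primitive_mul (x y : A) :
    (x ⊗ₜ[R] 1 + 1 ⊗ₜ[R] x) * (y ⊗ₜ[R] 1 + 1 ⊗ₜ[R] y)
      - (y ⊗ₜ[R] 1 + 1 ⊗ₜ[R] y) * (x ⊗ₜ[R] 1 + 1 ⊗ₜ[R] x) =
      (x * y - y * x) ⊗ₜ[R] 1 + 1 ⊗ₜ[R] (x * y - y * x) := by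
  simp only [mul_add, add_mul, Algebra.TensorProduct.tmul_mul_tmul, mul_one, one_mul,
    TensorProduct.sub_tmul, TensorProduct.tmul_sub]
  abel

/-- If `y` commutes with `z`, then the commutator of `x ⊗ z - z ⊗ x` with the primitive element
`y ⊗ 1 + 1 ⊗ y` is obtained by replacing `x` with `[x, y]`. -/
theorem wedge_mul_primitive {x y z w : A} (hxy : x * y - y * x = w) (hzy : Commute z y) :
    (x ⊗ₜ[R] z - z ⊗ₜ[R] x) * (y ⊗ₜ[R] 1 + 1 ⊗ₜ[R] y)
      - (y ⊗ₜ[R] 1 + 1 ⊗ₜ[R] y) * (x ⊗ₜ[R] z - z ⊗ₜ[R] x) =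
      w ⊗ₜ[R] z - z ⊗ₜ[R] w := by
  subst hxy
  simp only [mul_add, add_mul, mul_sub, sub_mul, Algebra.TensorProduct.tmul_mul_tmul, mul_one,
    one_mul, TensorProduct.sub_tmul, TensorProduct.tmul_sub, hzy.eq]
  abel

/-- If `x` and `y` commute with `z`, then the commutator of `x ⊗ z - z ⊗ x` and `y ⊗ z - z ⊗ y`
is `[x, y] ⊗ z² + z² ⊗ [x, y]`. -/
theorem wedge_mul_wedge {x y z w : A} (hxy : x * y - y * x = w) (hzx : Commute z x)
    (hzy : Commute z y) :
    (x ⊗ₜ[R] z - z ⊗ₜ[R] x) * (y ⊗ₜ[R] z - z ⊗ₜ[R] y)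
      - (y ⊗ₜ[R] z - z ⊗ₜ[R] y) * (x ⊗ₜ[R] z - z ⊗ₜ[R] x) =
      w ⊗ₜ[R] (z ^ 2) + (z ^ 2) ⊗ₜ[R] w := by
  subst hxy
  simp only [mul_sub, sub_mul, Algebra.TensorProduct.tmul_mul_tmul,
    TensorProduct.sub_tmul, TensorProduct.tmul_sub, hzx.eq, hzy.eq, pow_two]
  abel

end TensorCommutators

/-- With `[a m, a n] = m δ_{m+n,0} • a 0`, `[a 0, a m] = 0` and
`[a m, b n] = m • a (m+n)`, and `Δ(b m) = b m ⊗ 1 + 1 ⊗ b m + ε m · m • (a m ⊗ a 0 − a 0 ⊗ a m)`,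
one has
`[Δ(b m), Δ(b n)] = [b m, b n] ⊗ 1 + 1 ⊗ [b m, b n]
  + (ε m · m² − ε n · n²) • (a (m+n) ⊗ a 0 − a 0 ⊗ a (m+n))
  − δ_{m+n,0} ε m ε (−m) m³ • (a 0 ⊗ a 0² + a 0² ⊗ a 0)`. -/
theorem coproduct_bracket_bb
    {A : Type*} [Ring A] [Algebra ℂ A]
    (a b : ℤ → A)
    (haa : ∀ m n : ℤ, a m * a n - a n * a m =
      (if m + n = 0 then (m : ℂ) else 0) • a 0)
    (ha0 : ∀ m : ℤ, a 0 * a m - a m * a 0 = 0)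
    (hab : ∀ m n : ℤ, a m * b n - b n * a m = (m : ℂ) • a (m + n))
    (ε : ℤ → ℂ)
    (Δb : ℤ → A ⊗[ℂ] A)
    (hΔb : ∀ m : ℤ, Δb m = b m ⊗ₜ[ℂ] 1 + 1 ⊗ₜ[ℂ] b m
      + (ε m * m) • (a m ⊗ₜ[ℂ] a 0 - a 0 ⊗ₜ[ℂ] a m)) :
    ∀ m n : ℤ,
      Δb m * Δb n - Δb n * Δb m =
        (b m * b n - b n * b m) ⊗ₜ[ℂ] 1 + 1 ⊗ₜ[ℂ] (b m * b n - b n * b m)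
          + (ε m * (m : ℂ) ^ 2 - ε n * (n : ℂ) ^ 2) •
              (a (m + n) ⊗ₜ[ℂ] a 0 - a 0 ⊗ₜ[ℂ] a (m + n))
          - ((if m + n = 0 then (1 : ℂ) else 0) * ε m * ε (-m) * (m : ℂ) ^ 3) •
              (a 0 ⊗ₜ[ℂ] (a 0 ^ 2) + (a 0 ^ 2) ⊗ₜ[ℂ] a 0) := by
  intro m n
  have hcomm_a (k : ℤ) : Commute (a 0) (a k) := sub_eq_zero.mp (ha0 k)
  have hcomm_b (k : ℤ) : Commute (a 0) (b k) := sub_eq_zero.mp (by simpa using hab 0 k)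
  have hBB := primitive_mul_sub_primitive_mul (R := ℂ) (b m) (b n)
  have hXB := wedge_mul_primitive (R := ℂ) (hab m n) (hcomm_b n)
  have hYB := wedge_mul_primitive (R := ℂ) (hab n m) (hcomm_b m)
  have hXY := wedge_mul_wedge (R := ℂ) (haa m n) (hcomm_a m) (hcomm_a n)
  have hcoeff : (ε m * m) * (ε n * n) * (if m + n = 0 then (m : ℂ) else 0) =
      -((if m + n = 0 then (1 : ℂ) else 0) * ε m * ε (-m) * (m : ℂ) ^ 3) := by
    split_ifs with h
    · obtain rfl : n = -m := by lia
      push_cast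
      ring
    · simp
  simp only [← TensorProduct.smul_tmul', TensorProduct.tmul_smul, ← smul_sub, ← smul_add]
    at hXB hYB hXY
  rw [add_comm n m] at hYB
  rw [← hBB, sub_eq_add_neg _ (_ • _), ← neg_smul, ← hcoeff, mul_smul _ (ite _ _ _),
    ← hXY, hΔb, hΔb,
    sub_smul, pow_two, pow_two, ← mul_assoc, ← mul_assoc, mul_smul (ε m * m) (m : ℂ),
    mul_smul (ε n * n) (n : ℂ), ← hXB, ← hYB]
  simp only [add_mul (_ + _) (_ • _), mul_add _ (_ + _) (_ • _), smul_mul_assoc, mul_smul_comm]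
  module
end

section
/- Let c ∈ ℂ and let p be a polynomial in ℂ[X]. Then the identity p(X + Y) − p(X) − p(Y) = c·(X²·Y + X·Y²) holds in the polynomial ring ℂ[X, Y] if and only if there exists α ∈ ℂ such that p(X) = α·X + (c/3)·X³. -/
/-- An additive polynomial over a domain of characteristic zero is linear. -/
theorem Polynomial.eq_C_mul_X_of_eval_add {R : Type*} [CommRing R] [IsDomain R] [CharZero R]
    (q : Polynomial R) (hq : ∀ x y : R, q.eval (x + y) = q.eval x + q.eval y) :
    q = Polynomial.C (q.eval 1) * Polynomial.X := by
  have eval_natCast (n : ℕ) : q.eval (n : R) = q.eval 1 * n := by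
    simpa [mul_comm] using map_nsmul (AddMonoidHom.mk' (fun x => q.eval x) hq) n 1
  refine Polynomial.eq_of_infinite_eval_eq _ _
    ((Set.infinite_range_of_injective (Nat.cast_injective (R := R))).mono ?_)
  rintro _ ⟨n, rfl⟩
  simp [eval_natCast]

/-- For `c ∈ ℂ` and `p ∈ ℂ[X]`, the identity
`p(X+Y) − p(X) − p(Y) = c (X²Y + XY²)` holds in `ℂ[X,Y]` iff
`p = α X + (c/3) X³` for some `α ∈ ℂ`. -/
theorem cubic_coproduct_defect_iff
    (c : ℂ) (p : Polynomial ℂ) :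
    (Polynomial.aeval (MvPolynomial.X 0 + MvPolynomial.X 1 : MvPolynomial (Fin 2) ℂ) p
        - Polynomial.aeval (MvPolynomial.X 0 : MvPolynomial (Fin 2) ℂ) p
        - Polynomial.aeval (MvPolynomial.X 1 : MvPolynomial (Fin 2) ℂ) p =
      c • ((MvPolynomial.X 0) ^ 2 * MvPolynomial.X 1
        + MvPolynomial.X 0 * (MvPolynomial.X 1) ^ 2)) ↔
    ∃ α : ℂ, p = Polynomial.C α * Polynomial.X
      + Polynomial.C (c / 3) * Polynomial.X ^ 3 := by
  constructor
  · intro h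
    have defect (x y : ℂ) :
        p.eval (x + y) - p.eval x - p.eval y = c * (x ^ 2 * y + x * y ^ 2) := by
      have := congrArg (MvPolynomial.aeval ![x, y]) h
      simp only [map_sub, ← Polynomial.aeval_algHom_apply] at this
      simpa [Polynomial.coe_aeval_eq_eval, mul_add] using this
    have linear := Polynomial.eq_C_mul_X_of_eval_add
      (p - Polynomial.C (c / 3) * Polynomial.X ^ 3) fun x y => by
        simp only [Polynomial.eval_sub, Polynomial.eval_mul, Polynomial.eval_C,
          Polynomial.eval_pow, Polynomial.eval_X]
        linear_combination defect x y
    exact ⟨_, sub_eq_iff_eq_add.mp linear⟩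
  · rintro ⟨α, rfl⟩
    have hc : (MvPolynomial.C c : MvPolynomial (Fin 2) ℂ) = 3 * MvPolynomial.C (c / 3) := by
      rw [← map_ofNat (MvPolynomial.C : ℂ →+* MvPolynomial (Fin 2) ℂ) 3, ← map_mul]
      congr 1
      ring
    simp only [map_add, map_mul, map_pow, Polynomial.aeval_X, Polynomial.aeval_C,
      MvPolynomial.algebraMap_eq, MvPolynomial.smul_eq_C_mul, hc]
    ring
end

section
/- Let V be a vector space over ℂ, let A ∈ V be nonzero, let u, v ∈ V, and let f : ℤ → ℂ be such that for every integer m ≥ 1: m³·u + m·v + m³·f_m·A = 0. Then u = (1/3)·(f_1 − 4·f_2)·A, v = (4/3)·(f_2 − f_1)·A, and for every integer m ≥ 1: f_m = (1/3)·(4·f_2 − f_1) + (4/(3·m²))·(f_1 − f_2); equivalently f_m = f_1 + (4/3)·(f_2 − f_1)·(1 − 1/m²). -/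
/-- If `A ≠ 0` in a ℂ-vector space `V` and
`m³ • u + m • v + m³ f m • A = 0` for every integer `m ≥ 1`, then
`u = (1/3)(f 1 − 4 f 2) • A`, `v = (4/3)(f 2 − f 1) • A`, and for every `m ≥ 1`
`f m = (1/3)(4 f 2 − f 1) + (4/(3m²))(f 1 − f 2)`, equivalently
`f m = f 1 + (4/3)(f 2 − f 1)(1 − 1/m²)`. -/
theorem solve_epsilon_system
    {V : Type*} [AddCommGroup V] [Module ℂ V]
    (A : V) (hA : A ≠ 0) (u v : V) (f : ℤ → ℂ)
    (h : ∀ m : ℤ, 1 ≤ m →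
      (m : ℂ) ^ 3 • u + (m : ℂ) • v + ((m : ℂ) ^ 3 * f m) • A = 0) :
    u = ((1 / 3 : ℂ) * (f 1 - 4 * f 2)) • A ∧
    v = ((4 / 3 : ℂ) * (f 2 - f 1)) • A ∧
    ∀ m : ℤ, 1 ≤ m →
      f m = (1 / 3) * (4 * f 2 - f 1) + (4 / (3 * (m : ℂ) ^ 2)) * (f 1 - f 2) ∧
      f m = f 1 + (4 / 3) * (f 2 - f 1) * (1 - 1 / (m : ℂ) ^ 2) := by
  have h1 := h 1 le_rfl
  have h2 := h 2 one_le_two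
  push_cast at h1 h2
  have hu : u = ((1 / 3 : ℂ) * (f 1 - 4 * f 2)) • A := by
    linear_combination (norm := module) (1 / 6 : ℂ) • h2 - (1 / 3 : ℂ) • h1
  have hv : v = ((4 / 3 : ℂ) * (f 2 - f 1)) • A := by
    linear_combination (norm := module) (4 / 3 : ℂ) • h1 - (1 / 6 : ℂ) • h2
  refine ⟨hu, hv, fun m hm => ?_⟩
  have hm0 : (m : ℂ) ≠ 0 := by
    exact_mod_cast (by lia : m ≠ 0)
  have hmA := h m hm
  rw [hu, hv, smul_smul, smul_smul, ← add_smul, ← add_smul] at hmA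
  have hcoeff := (smul_eq_zero.mp hmA).resolve_right hA
  have hf : (m : ℂ) ^ 2 * f m =
      (m : ℂ) ^ 2 * ((1 / 3) * (4 * f 2 - f 1)) + (4 / 3) * (f 1 - f 2) :=
    mul_left_cancel₀ hm0 (by linear_combination hcoeff)
  constructor
  · field_simp
    linear_combination 3 * hf
  · field_simp
    linear_combination 3 * hf
end
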